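/- (Simulation lemma.) Let P̂ be a second transition dynamics on the same state and action spaces, and let Ĵ(π) denote the expected total discounted cost of a policy π under P̂ (with the same cost c ∈ [0,1], initial distribution ρ₀, and discount γ). Then for any policy π, |J(π) − Ĵ(π)| ≤ (γ/(2(1−γ)²)) · E_{(s,a)∼d_π π}[‖P̂_{s,a} − P_{s,a}‖₁], where d_π is the discounted state visitation distribution of π under the true dynamics P. -/

import Mathlib

open scoped BigOperators

noncomputable section

/-- `p` is a probability distribution on a finite type. -/
def IsDist {X : Type*} [Fintype X] (p : X → ℝ) : Prop :=
  (∀ x, 0 ≤ p x) ∧ ∑ x, p x = 1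

/-- `P` is a transition dynamics: `P s a` is a distribution over next states. -/
def IsDynamics {S A : Type*} [Fintype S] (P : S → A → S → ℝ) : Prop :=
  ∀ s a, IsDist (P s a)

/-- `π` is a (stochastic) policy: `π s` is a distribution over actions. -/
def IsPolicy {S A : Type*} [Fintype A] (π : S → A → ℝ) : Prop :=
  ∀ s, IsDist (π s)

/-- One-step evolution of a state distribution under policy `π` and dynamics `P`. -/
def step {S A : Type*} [Fintype S] [Fintype A]
    (P : S → A → S → ℝ) (π : S → A → ℝ) (d : S → ℝ) : S → ℝ :=
  fun s' => ∑ s, ∑ a, d s * π s a * P s a s'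

/-- The time-`t` state distribution `d_π^t` starting from `ρ₀`. -/
def stateDist {S A : Type*} [Fintype S] [Fintype A]
    (P : S → A → S → ℝ) (π : S → A → ℝ) (ρ₀ : S → ℝ) : ℕ → S → ℝ
  | 0 => ρ₀
  | t + 1 => step P π (stateDist P π ρ₀ t)

/-- Discounted state visitation distribution `d_π = (1-γ) Σ_t γ^t d_π^t`. -/
def visit {S A : Type*} [Fintype S] [Fintype A]
    (γ : ℝ) (P : S → A → S → ℝ) (π : S → A → ℝ) (ρ₀ : S → ℝ) : S → ℝ :=
  fun s => (1 - γ) * ∑' t : ℕ, γ ^ t * stateDist P π ρ₀ t s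

/-- Expected cost of one step when the state is distributed as `d` and actions follow `π`. -/
def expCost {S A : Type*} [Fintype S] [Fintype A]
    (c : S → A → ℝ) (π : S → A → ℝ) (d : S → ℝ) : ℝ :=
  ∑ s, ∑ a, d s * π s a * c s a

/-- Value function `V^π(s₀)`: expected total discounted cost starting at `s₀`. -/
def Vf {S A : Type*} [Fintype S] [Fintype A] [DecidableEq S]
    (γ : ℝ) (P : S → A → S → ℝ) (c : S → A → ℝ) (π : S → A → ℝ) (s₀ : S) : ℝ :=
  ∑' t : ℕ, γ ^ t * expCost c π (stateDist P π (fun s => if s = s₀ then 1 else 0) t)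

/-- Objective `J(π) = E_{s∼ρ₀}[V^π(s)]`. -/
def Jf {S A : Type*} [Fintype S] [Fintype A] [DecidableEq S]
    (γ : ℝ) (P : S → A → S → ℝ) (c : S → A → ℝ) (ρ₀ : S → ℝ) (π : S → A → ℝ) : ℝ :=
  ∑ s, ρ₀ s * Vf γ P c π s

/-- State-action value `Q^π(s,a) = c(s,a) + γ E_{s'∼P_{s,a}}[V^π(s')]`. -/
def Qf {S A : Type*} [Fintype S] [Fintype A] [DecidableEq S]
    (γ : ℝ) (P : S → A → S → ℝ) (c : S → A → ℝ) (π : S → A → ℝ) (s : S) (a : A) : ℝ :=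
  c s a + γ * ∑ s', P s a s' * Vf γ P c π s'

/-- Disadvantage function `A^π(s,a) = Q^π(s,a) - V^π(s)`. -/
def Adv {S A : Type*} [Fintype S] [Fintype A] [DecidableEq S]
    (γ : ℝ) (P : S → A → S → ℝ) (c : S → A → ℝ) (π : S → A → ℝ) (s : S) (a : A) : ℝ :=
  Qf γ P c π s a - Vf γ P c π s

section Helpers

variable {S A : Type*} [Fintype S] [Fintype A]

lemma IsDist.step {P : S → A → S → ℝ} {π : S → A → ℝ} {d : S → ℝ}
    (hP : IsDynamics P) (hπ : IsPolicy π) (hd : IsDist d) : IsDist (step P π d) := by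
  refine ⟨fun s' => Finset.sum_nonneg fun s _ => Finset.sum_nonneg fun a _ =>
    mul_nonneg (mul_nonneg (hd.1 s) ((hπ s).1 a)) ((hP s a).1 s'), ?_⟩
  unfold _root_.step
  rw [Finset.sum_comm]
  calc ∑ s, ∑ s', ∑ a, d s * π s a * P s a s' = ∑ s, d s := by
        refine Finset.sum_congr rfl fun s _ => ?_
        rw [Finset.sum_comm]
        simp_rw [← Finset.mul_sum, (hP s _).2, mul_one, ← Finset.mul_sum, (hπ s).2, mul_one]
    _ = 1 := hd.2

lemma IsDist.stateDist {P : S → A → S → ℝ} {π : S → A → ℝ} {d : S → ℝ}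
    (hP : IsDynamics P) (hπ : IsPolicy π) (hd : IsDist d) (t : ℕ) :
    IsDist (stateDist P π d t) := by
  induction t with
  | zero => exact hd
  | succ t ih => exact ih.step hP hπ

lemma IsDist.le_one {X : Type*} [Fintype X] {p : X → ℝ} (hp : IsDist p) (x : X) : p x ≤ 1 :=
  hp.2 ▸ Finset.single_le_sum (fun y _ => hp.1 y) (Finset.mem_univ x)

lemma isDist_dirac [DecidableEq S] (s₀ : S) : IsDist (fun s => if s = s₀ then (1 : ℝ) else 0) :=
  ⟨fun s => by dsimp only; split_ifs <;> norm_num, by simp⟩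

lemma expCost_mem_Icc {c : S → A → ℝ} {π : S → A → ℝ} {d : S → ℝ}
    (hc : ∀ s a, 0 ≤ c s a ∧ c s a ≤ 1) (hπ : IsPolicy π) (hd : IsDist d) :
    expCost c π d ∈ Set.Icc (0 : ℝ) 1 := by
  have hw : ∀ s a, 0 ≤ d s * π s a := fun s a => mul_nonneg (hd.1 s) ((hπ s).1 a)
  refine ⟨Finset.sum_nonneg fun s _ => Finset.sum_nonneg fun a _ =>
    mul_nonneg (hw s a) (hc s a).1, ?_⟩
  calc expCost c π d ≤ ∑ s, ∑ a, d s * π s a :=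
        Finset.sum_le_sum fun s _ => Finset.sum_le_sum fun a _ =>
          mul_le_of_le_one_right (hw s a) (hc s a).2
    _ = 1 := by simp_rw [← Finset.mul_sum, (hπ _).2, mul_one, hd.2]

lemma summable_geometric_mul_of_bounded {γ C : ℝ} (hγ : 0 < γ) (hγ' : γ < 1) {f : ℕ → ℝ}
    (hf : ∀ t, |f t| ≤ C) : Summable fun t => γ ^ t * f t := by
  refine Summable.of_norm_bounded
    ((summable_geometric_of_lt_one hγ.le hγ').mul_right C) fun t => ?_
  rw [Real.norm_eq_abs, abs_mul, abs_of_pos (pow_pos hγ t)]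
  exact mul_le_mul_of_nonneg_left (hf t) (pow_pos hγ t).le

lemma summable_discounted_expCost {γ : ℝ} {P : S → A → S → ℝ} {c : S → A → ℝ} {d : S → ℝ}
    {π : S → A → ℝ} (hγ : 0 < γ) (hγ' : γ < 1) (hP : IsDynamics P) (hπ : IsPolicy π)
    (hd : IsDist d) (hc : ∀ s a, 0 ≤ c s a ∧ c s a ≤ 1) :
    Summable fun t => γ ^ t * expCost c π (stateDist P π d t) := by
  refine summable_geometric_mul_of_bounded hγ hγ' (C := 1) fun t => ?_
  have h := expCost_mem_Icc hc hπ (hd.stateDist hP hπ t)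
  rw [abs_of_nonneg h.1]
  exact h.2

lemma stateDist_succ_eq (P : S → A → S → ℝ) (π : S → A → ℝ) (d : S → ℝ) (t : ℕ) :
    stateDist P π d (t + 1) = stateDist P π (step P π d) t := by
  induction t with
  | zero => rfl
  | succ t ih =>
    change step P π (stateDist P π d (t + 1)) = _
    rw [ih]
    rfl

lemma step_sum {ι : Type*} [Fintype ι] (P : S → A → S → ℝ) (π : S → A → ℝ) (w : ι → ℝ)
    (d : ι → S → ℝ) :
    step P π (fun s => ∑ i, w i * d i s) = fun s => ∑ i, w i * step P π (d i) s := by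
  funext s'
  simp only [step, Finset.sum_mul, Finset.mul_sum]
  rw [Finset.sum_comm_cycle]
  refine Finset.sum_congr rfl fun i _ => Finset.sum_congr rfl fun s _ =>
    Finset.sum_congr rfl fun a _ => by ring

lemma expCost_sum {ι : Type*} [Fintype ι] (c : S → A → ℝ) (π : S → A → ℝ) (w : ι → ℝ)
    (d : ι → S → ℝ) :
    expCost c π (fun s => ∑ i, w i * d i s) = ∑ i, w i * expCost c π (d i) := by
  simp only [expCost, Finset.sum_mul, Finset.mul_sum]
  rw [Finset.sum_comm_cycle]
  refine Finset.sum_congr rfl fun i _ => Finset.sum_congr rfl fun s _ =>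
    Finset.sum_congr rfl fun a _ => by ring

/-- Two distributions integrate a function of range `[0, M]` within `M / 2` times their
`ℓ¹` distance. -/
lemma abs_sum_sub_mul_le {p q v : S → ℝ} {M : ℝ} (hp : IsDist p) (hq : IsDist q)
    (hv : ∀ s, v s ∈ Set.Icc 0 M) :
    |∑ s, (p s - q s) * v s| ≤ M / 2 * ∑ s, |q s - p s| := by
  have hcenter : ∑ s, (p s - q s) * v s = ∑ s, (p s - q s) * (v s - M / 2) := by
    simp_rw [mul_sub, Finset.sum_sub_distrib, ← Finset.sum_mul, Finset.sum_sub_distrib, hp.2, hq.2]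
    ring
  rw [hcenter, Finset.mul_sum]
  refine (Finset.abs_sum_le_sum_abs _ _).trans (Finset.sum_le_sum fun s _ => ?_)
  rw [abs_mul, abs_sub_comm (p s), mul_comm]
  refine mul_le_mul_of_nonneg_right ?_ (abs_nonneg _)
  rw [abs_le]
  constructor <;> linarith [(hv s).1, (hv s).2]

lemma abs_sum_step_sub_step_mul_le {P Q : S → A → S → ℝ} {π : S → A → ℝ} {d v : S → ℝ} {M : ℝ}
    (hP : IsDynamics P) (hQ : IsDynamics Q) (hπ : IsPolicy π) (hd : IsDist d)
    (hv : ∀ s, v s ∈ Set.Icc 0 M) :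
    |∑ s', (step P π d s' - step Q π d s') * v s'| ≤
      M / 2 * ∑ s, ∑ a, d s * π s a * ∑ s', |Q s a s' - P s a s'| := by
  have hexp : ∑ s', (step P π d s' - step Q π d s') * v s' =
      ∑ s, ∑ a, d s * π s a * ∑ s', (P s a s' - Q s a s') * v s' := by
    simp only [step, ← Finset.sum_sub_distrib, Finset.sum_mul, Finset.mul_sum]
    rw [Finset.sum_comm]
    refine Finset.sum_congr rfl fun s _ => ?_
    rw [Finset.sum_comm]
    exact Finset.sum_congr rfl fun a _ => Finset.sum_congr rfl fun s' _ => by ring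
  rw [hexp, Finset.mul_sum]
  refine (Finset.abs_sum_le_sum_abs _ _).trans (Finset.sum_le_sum fun s _ => ?_)
  rw [Finset.mul_sum]
  refine (Finset.abs_sum_le_sum_abs _ _).trans (Finset.sum_le_sum fun a _ => ?_)
  have hw : 0 ≤ d s * π s a := mul_nonneg (hd.1 s) ((hπ s).1 a)
  rw [abs_mul, abs_of_nonneg hw, mul_left_comm]
  exact mul_le_mul_of_nonneg_left (abs_sum_sub_mul_le (hP s a) (hQ s a) hv) hw

/-- The expectation of `f` under the visitation distribution is the discounted sum of its
expectations under the time-`t` distributions. -/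
lemma hasSum_visit {γ : ℝ} {P : S → A → S → ℝ} {π : S → A → ℝ} {ρ₀ : S → ℝ}
    (hγ : 0 < γ) (hγ' : γ < 1) (hP : IsDynamics P) (hπ : IsPolicy π) (hρ : IsDist ρ₀)
    (f : S → A → ℝ) :
    HasSum (fun t => γ ^ t * ∑ s, ∑ a, stateDist P π ρ₀ t s * π s a * f s a)
      ((1 - γ)⁻¹ * ∑ s, ∑ a, visit γ P π ρ₀ s * π s a * f s a) := by
  have hs : ∀ s, HasSum (fun t => γ ^ t * stateDist P π ρ₀ t s)
      ((1 - γ)⁻¹ * visit γ P π ρ₀ s) := fun s => by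
    rw [visit, inv_mul_cancel_left₀ (sub_pos.2 hγ').ne']
    refine (summable_geometric_mul_of_bounded hγ hγ' (C := 1) fun t => ?_).hasSum
    have h := hρ.stateDist hP hπ t
    rw [abs_of_nonneg (h.1 s)]
    exact h.le_one s
  simp_rw [Finset.mul_sum, ← mul_assoc]
  exact hasSum_sum fun s _ => hasSum_sum fun a _ => ((hs s).mul_right _).mul_right _

variable [DecidableEq S]

lemma stateDist_eq_sum_dirac (P : S → A → S → ℝ) (π : S → A → ℝ) (d : S → ℝ) (t : ℕ) :
    stateDist P π d t =
      fun s => ∑ x, d x * stateDist P π (fun s => if s = x then 1 else 0) t s := by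
  induction t with
  | zero => funext s; simp [stateDist]
  | succ t ih =>
    change step P π (stateDist P π d t) = _
    rw [ih, step_sum]
    rfl

lemma Jf_eq_tsum {γ : ℝ} {P : S → A → S → ℝ} {c : S → A → ℝ} {π : S → A → ℝ}
    (hγ : 0 < γ) (hγ' : γ < 1) (hP : IsDynamics P) (hπ : IsPolicy π)
    (hc : ∀ s a, 0 ≤ c s a ∧ c s a ≤ 1) (d : S → ℝ) :
    Jf γ P c d π = ∑' t : ℕ, γ ^ t * expCost c π (stateDist P π d t) := by
  have hs := fun x : S => summable_discounted_expCost hγ hγ' hP hπ (isDist_dirac x) hc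
  simp only [Jf, Vf, ← tsum_mul_left]
  rw [← Summable.tsum_finsetSum fun x _ => (hs x).mul_left (d x)]
  refine tsum_congr fun t => ?_
  rw [stateDist_eq_sum_dirac P π d t, expCost_sum, Finset.mul_sum]
  exact Finset.sum_congr rfl fun x _ => by ring

lemma Jf_bellman {γ : ℝ} {P : S → A → S → ℝ} {c : S → A → ℝ} {π : S → A → ℝ} {d : S → ℝ}
    (hγ : 0 < γ) (hγ' : γ < 1) (hP : IsDynamics P) (hπ : IsPolicy π) (hd : IsDist d)
    (hc : ∀ s a, 0 ≤ c s a ∧ c s a ≤ 1) :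
    Jf γ P c d π = expCost c π d + γ * Jf γ P c (step P π d) π := by
  rw [Jf_eq_tsum hγ hγ' hP hπ hc, Jf_eq_tsum hγ hγ' hP hπ hc,
    (summable_discounted_expCost hγ hγ' hP hπ hd hc).tsum_eq_zero_add, ← tsum_mul_left]
  congr 1
  · simp [stateDist]
  · refine tsum_congr fun t => ?_
    rw [stateDist_succ_eq, pow_succ']
    ring

lemma Vf_mem_Icc {γ : ℝ} {P : S → A → S → ℝ} {c : S → A → ℝ} {π : S → A → ℝ}
    (hγ : 0 < γ) (hγ' : γ < 1) (hP : IsDynamics P) (hπ : IsPolicy π)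
    (hc : ∀ s a, 0 ≤ c s a ∧ c s a ≤ 1) (s : S) :
    Vf γ P c π s ∈ Set.Icc 0 (1 - γ)⁻¹ := by
  have h := fun t => expCost_mem_Icc hc hπ ((isDist_dirac s).stateDist hP hπ t)
  refine ⟨tsum_nonneg fun t => mul_nonneg (pow_pos hγ t).le (h t).1, ?_⟩
  rw [← tsum_geometric_of_lt_one hγ.le hγ']
  exact Summable.tsum_le_tsum (fun t => mul_le_of_le_one_right (pow_pos hγ t).le (h t).2)
    (summable_discounted_expCost hγ hγ' hP hπ (isDist_dirac s) hc)
    (summable_geometric_of_lt_one hγ.le hγ')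

end Helpers

/-- **Simulation lemma.** For any policy `π`,
`|J(π) - Ĵ(π)| ≤ (γ/(2(1-γ)²)) * E_{(s,a)∼d_π π}[‖P̂_{s,a} - P_{s,a}‖₁]`,
where `Ĵ` is the expected total discounted cost under the model `P̂` and `d_π` is taken
under the true dynamics `P`. -/
theorem simulation_lemma
    {S A : Type*} [Fintype S] [Fintype A] [DecidableEq S]
    (γ : ℝ) (P Phat : S → A → S → ℝ) (c : S → A → ℝ) (ρ₀ : S → ℝ)
    (hγ : 0 < γ) (hγ' : γ < 1) (hP : IsDynamics P) (hPhat : IsDynamics Phat) (hρ : IsDist ρ₀)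
    (hc : ∀ s a, 0 ≤ c s a ∧ c s a ≤ 1)
    (π : S → A → ℝ) (hπ : IsPolicy π) :
    |Jf γ P c ρ₀ π - Jf γ Phat c ρ₀ π| ≤
      (γ / (2 * (1 - γ) ^ 2)) *
        ∑ s, ∑ a, visit γ P π ρ₀ s * π s a * (∑ s', |Phat s a s' - P s a s'|) := by
  have hD := fun t => hρ.stateDist hP hπ t
  have hV := Vf_mem_Icc hγ hγ' hPhat hπ hc
  set D : ℕ → ℝ := fun t => Jf γ Phat c (stateDist P π ρ₀ t) π with hDdef
  set ε : ℕ → ℝ := fun t => ∑ s', (step P π (stateDist P π ρ₀ t) s' -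
    step Phat π (stateDist P π ρ₀ t) s') * Vf γ Phat c π s' with hε
  have hε_eq : ∀ t, γ * (γ ^ t * ε t) =
      γ ^ t * expCost c π (stateDist P π ρ₀ t) - (γ ^ t * D t - γ ^ (t + 1) * D (t + 1)) := by
    intro t
    have h1 : ε t = D (t + 1) - Jf γ Phat c (step Phat π (stateDist P π ρ₀ t)) π := by
      simp only [hε, hDdef, Jf, stateDist, sub_mul, Finset.sum_sub_distrib]
    have h2 : D t = _ := Jf_bellman hγ hγ' hPhat hπ (hD t) hc
    rw [h1, h2]
    ring
  have hD_sum : Summable fun t => γ ^ t * D t := by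
    refine summable_geometric_mul_of_bounded hγ hγ' (C := ∑ _s : S, (1 - γ)⁻¹) fun t => ?_
    refine (Finset.abs_sum_le_sum_abs _ _).trans (Finset.sum_le_sum fun s _ => ?_)
    rw [abs_of_nonneg (mul_nonneg ((hD t).1 s) (hV s).1)]
    exact (mul_le_of_le_one_left (hV s).1 ((hD t).le_one s)).trans (hV s).2
  have hD_tail : HasSum (fun t => γ ^ t * D t - γ ^ (t + 1) * D (t + 1)) (D 0) := by
    have h := hD_sum.hasSum.sub ((summable_nat_add_iff 1).2 hD_sum).hasSum
    rw [hD_sum.tsum_eq_zero_add] at h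
    simpa using h
  have hgap : HasSum (fun t => γ * (γ ^ t * ε t)) (Jf γ P c ρ₀ π - Jf γ Phat c ρ₀ π) := by
    simp_rw [hε_eq]
    rw [Jf_eq_tsum hγ hγ' hP hπ hc ρ₀]
    exact (summable_discounted_expCost hγ hγ' hP hπ hρ hc).hasSum.sub hD_tail
  have hbound := (hasSum_visit hγ hγ' hP hπ hρ
    fun s a => ∑ s', |Phat s a s' - P s a s'|).mul_left (γ * ((1 - γ)⁻¹ / 2))
  have hle : ∀ t, ‖γ * (γ ^ t * ε t)‖ ≤ γ * ((1 - γ)⁻¹ / 2) * (γ ^ t * ∑ s, ∑ a,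
      stateDist P π ρ₀ t s * π s a * ∑ s', |Phat s a s' - P s a s'|) := by
    intro t
    have hpos : 0 < γ * γ ^ t := mul_pos hγ (pow_pos hγ t)
    rw [Real.norm_eq_abs, ← mul_assoc, abs_mul, abs_of_pos hpos]
    refine (mul_le_mul_of_nonneg_left
      (abs_sum_step_sub_step_mul_le hP hPhat hπ (hD t) hV) hpos.le).trans_eq (by ring)
  have hfinal := tsum_of_norm_bounded hbound hle
  rw [hgap.tsum_eq, Real.norm_eq_abs] at hfinal
  refine hfinal.trans_eq ?_
  have hne : 1 - γ ≠ 0 := (sub_pos.2 hγ').ne'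
  field_simp
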